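/- If the (k,t)-Tree problem can be decided for every t from 1 to k, then k-IOB reduces to it: a directed graph G has an out-branching with at least k internal nodes if and only if there exist a node r and an integer 1 ≤ t ≤ k such that G has an out-tree rooted at r with exactly k internal nodes and exactly t leaves, AND every node of G is reachable from r. -/

import Mathlib

/-- An out-tree in a directed graph `G`, given by its node set, its root, and a parent
function: every non-root node has its parent in the tree, connected by an edge of `G`
directed away from the root, and every node reaches the root by iterating the parent
function. -/
structure OutTree (V : Type*) [Fintype V] [DecidableEq V] (G : V → V → Prop) where
  nodes : Finset V
  root : V
  root_mem : root ∈ nodes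
  par : V → V
  par_mem : ∀ v ∈ nodes, v ≠ root → par v ∈ nodes
  par_edge : ∀ v ∈ nodes, v ≠ root → G (par v) v
  reach : ∀ v ∈ nodes, ∃ m : ℕ, par^[m] v = root

/-- The number of internal nodes (out-degree ≥ 1) of an out-tree. -/
def OutTree.internalCount {V : Type*} [Fintype V] [DecidableEq V] {G : V → V → Prop}
    (T : OutTree V G) : ℕ :=
  (T.nodes.filter (fun v => ∃ u ∈ T.nodes, u ≠ T.root ∧ T.par u = v)).card

/-- The number of leaves (out-degree 0) of an out-tree. -/
def OutTree.leafCount {V : Type*} [Fintype V] [DecidableEq V] {G : V → V → Prop}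
    (T : OutTree V G) : ℕ :=
  (T.nodes.filter (fun v => ¬ ∃ u ∈ T.nodes, u ≠ T.root ∧ T.par u = v)).card

namespace OutTree

variable {V : Type*} [Fintype V] [DecidableEq V] {G : V → V → Prop}

/-- `v` has a child in `T`. -/
def HasChild (T : OutTree V G) (v : V) : Prop := ∃ u ∈ T.nodes, u ≠ T.root ∧ T.par u = v

theorem reachable (T : OutTree V G) (m : ℕ) :
    ∀ v ∈ T.nodes, T.par^[m] v = T.root → Relation.ReflTransGen G T.root v := by
  induction m with
  | zero => intro v _ h; simp at h; rw [h]
  | succ m ih =>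
    intro v hv h
    by_cases hr : v = T.root
    · rw [hr]
    · rw [Function.iterate_succ_apply] at h
      exact (ih _ (T.par_mem v hv hr) h).tail (T.par_edge v hv hr)

theorem root_hasChild_aux (T : OutTree V G) (m : ℕ) :
    ∀ v ∈ T.nodes, v ≠ T.root → T.par^[m] v = T.root → T.HasChild T.root := by
  induction m with
  | zero => intro v _ hr h; exact absurd h hr
  | succ m ih =>
    intro v hv hr h
    rw [Function.iterate_succ_apply] at h
    by_cases hp : T.par v = T.root
    · exact ⟨v, hv, hr, hp⟩
    · exact ih _ (T.par_mem v hv hr) hp h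

theorem root_hasChild (T : OutTree V G) (h : 1 ≤ T.internalCount) : T.HasChild T.root := by
  obtain ⟨v, hv⟩ := Finset.card_pos.mp h
  obtain ⟨_, u, hu, hr, _⟩ := Finset.mem_filter.mp hv
  obtain ⟨m, hm⟩ := T.reach u hu
  exact T.root_hasChild_aux m u hu hr hm

theorem one_le_leafCount (T : OutTree V G) : 1 ≤ T.leafCount := by
  by_contra hc
  have h0 : T.leafCount = 0 := by omega
  unfold leafCount at h0
  rw [Finset.card_eq_zero, Finset.filter_eq_empty_iff] at h0
  have hsub : T.nodes ⊆ (T.nodes.erase T.root).image T.par := by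
    intro v hv
    have := h0 hv
    push Not at this
    obtain ⟨u, hu, hr, he⟩ := this
    exact Finset.mem_image.mpr ⟨u, Finset.mem_erase.mpr ⟨hr, hu⟩, he⟩
  have h1 := Finset.card_le_card hsub
  have h2 := Finset.card_image_le (s := T.nodes.erase T.root) (f := T.par)
  have h3 := Finset.card_erase_lt_of_mem T.root_mem
  omega

/-- Delete a leaf. -/
def del (T : OutTree V G) (l : V) (hl : l ≠ T.root) (hc : ¬ T.HasChild l) : OutTree V G where
  nodes := T.nodes.erase l
  root := T.root
  root_mem := Finset.mem_erase.mpr ⟨hl.symm, T.root_mem⟩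
  par := T.par
  par_mem := fun v hv hr => Finset.mem_erase.mpr
    ⟨fun h => hc ⟨v, Finset.mem_of_mem_erase hv, hr, h⟩,
      T.par_mem v (Finset.mem_of_mem_erase hv) hr⟩
  par_edge := fun v hv hr => T.par_edge v (Finset.mem_of_mem_erase hv) hr
  reach := fun v hv => T.reach v (Finset.mem_of_mem_erase hv)

theorem internal_del (T : OutTree V G) (l : V) (hl : l ≠ T.root) (hc : ¬ T.HasChild l) :
    T.internalCount ≤ (T.del l hl hc).internalCount + 1 := by
  unfold internalCount
  refine le_trans (Finset.card_le_card ?_) (Finset.card_insert_le (T.par l) _)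
  intro v hv
  obtain ⟨hv, u, hu, hr, he⟩ := Finset.mem_filter.mp hv
  rw [Finset.mem_insert]
  by_cases hul : u = l
  · left; rw [← he, hul]
  · right
    refine Finset.mem_filter.mpr ⟨Finset.mem_erase.mpr ⟨?_, hv⟩, u,
      Finset.mem_erase.mpr ⟨hul, hu⟩, hr, he⟩
    rintro rfl
    exact hc ⟨u, hu, hr, he⟩

theorem internal_del' (T : OutTree V G) (l : V) (hl : l ≠ T.root) (hc : ¬ T.HasChild l)
    (w : V) (hw : w ∈ T.nodes) (hwr : w ≠ T.root) (hwl : w ≠ l) (hp : T.par w = T.par l) :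
    T.internalCount ≤ (T.del l hl hc).internalCount := by
  unfold internalCount
  refine Finset.card_le_card ?_
  intro v hv
  obtain ⟨hv, u, hu, hr, he⟩ := Finset.mem_filter.mp hv
  have hvl : v ≠ l := by
    rintro rfl
    exact hc ⟨u, hu, hr, he⟩
  refine Finset.mem_filter.mpr ⟨Finset.mem_erase.mpr ⟨hvl, hv⟩, ?_⟩
  by_cases hul : u = l
  · exact ⟨w, Finset.mem_erase.mpr ⟨hwl, hw⟩, hwr, by rw [← he, hul]; exact hp⟩
  · exact ⟨u, Finset.mem_erase.mpr ⟨hul, hu⟩, hr, he⟩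

theorem prune (k : ℕ) (hk : 1 ≤ k) (n : ℕ) : ∀ T : OutTree V G, T.nodes.card = n →
    k ≤ T.internalCount → ∃ T' : OutTree V G, T'.root = T.root ∧ T'.internalCount = k ∧
      T'.leafCount ≤ k := by
  induction n using Nat.strong_induction_on with
  | _ n ih =>
    intro T hn hT
    have hroot := T.root_hasChild (hk.trans hT)
    by_cases hex : ∃ (l : V) (_ : l ∈ T.nodes) (hl : l ≠ T.root) (hc : ¬ T.HasChild l),
        k ≤ (T.del l hl hc).internalCount
    · obtain ⟨l, hm, hl, hc, h⟩ := hex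
      have hlt := Finset.card_erase_lt_of_mem hm
      exact ih (T.nodes.erase l).card (hn ▸ hlt) (T.del l hl hc) rfl h
    · push Not at hex
      have hne : ∀ l, ¬ T.HasChild l → l ≠ T.root := by
        rintro l hc rfl; exact hc hroot
      have hint : T.internalCount = k := by
        obtain ⟨l, hl⟩ := Finset.card_pos.mp T.one_le_leafCount
        obtain ⟨hm, hc⟩ := Finset.mem_filter.mp hl
        have h1 := hex l hm (hne l hc) hc
        have h2 := T.internal_del l (hne l hc) hc
        omega
      refine ⟨T, rfl, hint, ?_⟩
      rw [← hint]
      unfold leafCount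
      refine Finset.card_le_card_of_injOn T.par ?_ ?_
      · intro l hl
        obtain ⟨hm, hc⟩ := Finset.mem_filter.mp hl
        exact Finset.mem_coe.mpr (Finset.mem_filter.mpr
          ⟨T.par_mem l hm (hne l hc), l, hm, hne l hc, rfl⟩)
      · intro l hl w hw h
        obtain ⟨hm, hc⟩ := Finset.mem_filter.mp hl
        obtain ⟨hwm, hwc⟩ := Finset.mem_filter.mp hw
        by_contra hlw
        have h1 := hex l hm (hne l hc) hc
        have h2 := T.internal_del' l (hne l hc) hc w hwm (hne w hwc) (Ne.symm hlw) h.symm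
        omega

theorem reach_update (T : OutTree V G) (a b : V) (hb : b ∉ T.nodes) (m : ℕ) :
    ∀ v ∈ T.nodes, T.par^[m] v = T.root →
      ∃ m', (Function.update T.par b a)^[m'] v = T.root := by
  induction m with
  | zero => intro v _ h; exact ⟨0, h⟩
  | succ m ih =>
    intro v hv h
    by_cases hr : v = T.root
    · exact ⟨0, hr⟩
    · rw [Function.iterate_succ_apply] at h
      obtain ⟨m', h'⟩ := ih _ (T.par_mem v hv hr) h
      refine ⟨m' + 1, ?_⟩
      rw [Function.iterate_succ_apply,
        Function.update_of_ne (fun h : v = b => hb (h ▸ hv))]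
      exact h'

theorem extend_one (T : OutTree V G) (a b : V) (ha : a ∈ T.nodes) (hb : b ∉ T.nodes)
    (hG : G a b) : ∃ T' : OutTree V G, T'.root = T.root ∧ T'.nodes = insert b T.nodes ∧
      T.internalCount ≤ T'.internalCount := by
  have hup : ∀ v ∈ T.nodes, Function.update T.par b a v = T.par v :=
    fun v hv => Function.update_of_ne (fun h : v = b => hb (h ▸ hv)) _ _
  refine ⟨{ nodes := insert b T.nodes
            root := T.root
            root_mem := Finset.mem_insert_of_mem T.root_mem
            par := Function.update T.par b a
            par_mem := ?_
            par_edge := ?_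
            reach := ?_ }, rfl, rfl, ?_⟩
  · intro v hv hr
    rcases Finset.mem_insert.mp hv with rfl | hv
    · rw [Function.update_self]; exact Finset.mem_insert_of_mem ha
    · rw [hup v hv]; exact Finset.mem_insert_of_mem (T.par_mem v hv hr)
  · intro v hv hr
    rcases Finset.mem_insert.mp hv with rfl | hv
    · rw [Function.update_self]; exact hG
    · rw [hup v hv]; exact T.par_edge v hv hr
  · intro v hv
    rcases Finset.mem_insert.mp hv with rfl | hv
    · obtain ⟨m, hm⟩ := T.reach a ha
      obtain ⟨m', h'⟩ := T.reach_update a v hb m a ha hm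
      refine ⟨m' + 1, ?_⟩
      rw [Function.iterate_succ_apply, Function.update_self]
      exact h'
    · obtain ⟨m, hm⟩ := T.reach v hv
      exact T.reach_update a b hb m v hv hm
  · unfold internalCount
    refine Finset.card_le_card ?_
    intro v hv
    obtain ⟨hv, u, hu, hr, he⟩ := Finset.mem_filter.mp hv
    exact Finset.mem_filter.mpr ⟨Finset.mem_insert_of_mem hv, u,
      Finset.mem_insert_of_mem hu, hr, (hup u hu).trans he⟩

theorem extend (n : ℕ) : ∀ T : OutTree V G, T.nodesᶜ.card = n →
    (∀ v, Relation.ReflTransGen G T.root v) →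
    ∃ T' : OutTree V G, T'.nodes = Finset.univ ∧ T.internalCount ≤ T'.internalCount := by
  induction n using Nat.strong_induction_on with
  | _ n ih =>
    intro T hn hreach
    by_cases hex : ∃ a b, a ∈ T.nodes ∧ b ∉ T.nodes ∧ G a b
    · obtain ⟨a, b, ha, hb, hG⟩ := hex
      obtain ⟨T1, hr, hnodes, hle⟩ := T.extend_one a b ha hb hG
      have hlt : T1.nodesᶜ.card < n := by
        rw [← hn, hnodes]
        exact Finset.card_lt_card
          (Finset.compl_ssubset_compl.mpr (Finset.ssubset_insert hb))
      obtain ⟨T2, h1, h2⟩ := ih _ hlt T1 rfl (by rw [hr]; exact hreach)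
      exact ⟨T2, h1, hle.trans h2⟩
    · push Not at hex
      refine ⟨T, ?_, le_rfl⟩
      rw [Finset.eq_univ_iff_forall]
      intro v
      induction hreach v with
      | refl => exact T.root_mem
      | tail _ hG ih' =>
        by_contra hb
        exact hex _ _ ih' hb hG

end OutTree



/-- `G` has an out-branching (spanning out-tree) with at least `k` internal nodes iff
there are a node `r` and `1 ≤ t ≤ k` such that `G` has an out-tree rooted at `r` with
exactly `k` internal nodes and exactly `t` leaves, and every node of `G` is reachable
from `r`. -/
theorem stmt18 {V : Type*} [Fintype V] [DecidableEq V] (G : V → V → Prop) (k : ℕ)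
    (hk : 1 ≤ k) :
    (∃ T : OutTree V G, T.nodes = Finset.univ ∧ k ≤ T.internalCount) ↔
    (∃ (r : V) (t : ℕ), 1 ≤ t ∧ t ≤ k ∧
      (∃ T : OutTree V G, T.root = r ∧ T.internalCount = k ∧ T.leafCount = t) ∧
      (∀ v : V, Relation.ReflTransGen G r v)) := by
  constructor
  · rintro ⟨T, hu, hT⟩
    obtain ⟨T', hr, hi, hl⟩ := OutTree.prune k hk _ T rfl hT
    refine ⟨T.root, T'.leafCount, T'.one_le_leafCount, hl, ⟨T', hr, hi, rfl⟩, ?_⟩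
    intro v
    have hv : v ∈ T.nodes := by rw [hu]; exact Finset.mem_univ v
    obtain ⟨m, hm⟩ := T.reach v hv
    exact T.reachable m v hv hm
  · rintro ⟨r, t, _, _, ⟨T, rfl, hi, _⟩, hreach⟩
    obtain ⟨T', h1, h2⟩ := OutTree.extend _ T rfl hreach
    exact ⟨T', h1, hi ▸ h2⟩
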